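/- arXiv:2309.10920 — 4 statements merged into one kernel-verified Lean document; each statement's English description precedes it below -/
import Mathlib

section
/- Let S be a commutative ring, B a commutative S-algebra, N a positive integer, and d₁, …, d_p ∈ B elements which generate B as an S-algebra. Suppose that for each 1 ≤ i ≤ p the element T_N(d_i), obtained by evaluating the N-th Chebyshev polynomial of the first kind at d_i, lies in the image of the structure map S → B. Then B is generated as an S-module by the N^p monomials d₁^{k₁}⋯d_p^{k_p} with 0 ≤ k_i ≤ N−1 for all i. -/
open Polynomial

/-- The Chebyshev polynomials of the first kind (in the normalization of the paper):
`T 0 = 2`, `T 1 = X`, `T (n+2) = X * T (n+1) - T n`. -/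
noncomputable def chebT : ℕ → Polynomial ℤ
  | 0 => 2
  | 1 => X
  | (n + 2) => X * chebT (n + 1) - chebT n

theorem chebT_succ_monic_and_natDegree (n : ℕ) :
    (chebT (n + 1)).Monic ∧ (chebT (n + 1)).natDegree = n + 1 ∧ (chebT n).natDegree ≤ n := by
  induction n with
  | zero =>
    refine ⟨?_, ?_, ?_⟩
    · simp [chebT, monic_X]
    · simp [chebT]
    · simp [chebT]
  | succ n ih =>
    obtain ⟨hmonic, hdeg, hle⟩ := ih
    have hX : (X * chebT (n + 1)).Monic := monic_X.mul hmonic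
    have hXdeg : (X * chebT (n + 1)).natDegree = n + 2 := by
      rw [monic_X.natDegree_mul hmonic, natDegree_X, hdeg]; omega
    have hlt : (chebT n).natDegree < (X * chebT (n + 1)).natDegree := by omega
    refine ⟨?_, ?_, hdeg.le⟩
    · simpa only [chebT] using hX.sub_of_left (degree_lt_degree hlt)
    · rw [chebT, natDegree_sub_eq_left_of_natDegree_lt hlt, hXdeg]

theorem chebT_monic {n : ℕ} (hn : 0 < n) : (chebT n).Monic := by
  obtain ⟨m, rfl⟩ := Nat.exists_eq_succ_of_ne_zero hn.ne'
  exact (chebT_succ_monic_and_natDegree m).1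

theorem natDegree_chebT {n : ℕ} (hn : 0 < n) : (chebT n).natDegree = n := by
  obtain ⟨m, rfl⟩ := Nat.exists_eq_succ_of_ne_zero hn.ne'
  exact (chebT_succ_monic_and_natDegree m).2.1

/-- If a monic integer polynomial `f` of degree `N > 0` takes at `x` a value coming from the base
ring, then every power of `x` is a linear combination of the powers `x ^ k` with `k < N`. -/
theorem exists_pow_eq_sum_of_aeval_mem_range {S B : Type*} [CommRing S] [CommRing B] [Algebra S B]
    {f : ℤ[X]} (hf : f.Monic) {N : ℕ} (hfN : f.natDegree = N) (hN : 0 < N) {x : B}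
    (hx : aeval x f ∈ (algebraMap S B).range) (n : ℕ) :
    ∃ c : Fin N → S, x ^ n = ∑ k, c k • x ^ (k : ℕ) := by
  obtain ⟨s, hs⟩ := hx
  nontriviality B
  have : Nontrivial S := (algebraMap S B).domain_nontrivial
  set g : S[X] := f.map (Int.castRingHom S) - C s with hg
  have hmap : (f.map (Int.castRingHom S)).natDegree = N := by rw [hf.natDegree_map, hfN]
  have hgmonic : g.Monic := by
    refine (hf.map _).sub_of_left (degree_lt_degree ?_)
    rw [natDegree_C, hmap]
    exact hN
  have hgdeg : g.natDegree = N := by rw [hg, natDegree_sub_C, hmap]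
  have hgx : aeval x g = 0 := by
    rw [hg, map_sub, aeval_C, hs, ← algebraMap_int_eq, aeval_map_algebraMap, sub_self]
  have hlt : (X ^ n %ₘ g).natDegree < N := by
    rw [← hgdeg]
    refine natDegree_modByMonic_lt _ hgmonic fun h => ?_
    rw [h, natDegree_one] at hgdeg
    omega
  refine ⟨fun k => (X ^ n %ₘ g).coeff k, ?_⟩
  rw [Fin.sum_univ_eq_sum_range (fun k => (X ^ n %ₘ g).coeff k • x ^ k), ← aeval_eq_sum_range' hlt,
    aeval_modByMonic_eq_self_of_root hgx, map_pow, aeval_X]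

theorem prod_mem_span_range_prod_pow {S B ι : Type*} [CommRing S] [CommRing B] [Algebra S B]
    [Fintype ι] {N : ℕ} (d : ι → B)
    (h : ∀ i (n : ℕ), ∃ c : Fin N → S, d i ^ n = ∑ k, c k • d i ^ (k : ℕ)) (e : ι → ℕ) :
    ∏ i, d i ^ e i ∈
      Submodule.span S (Set.range fun k : ι → Fin N => ∏ i, d i ^ (k i : ℕ)) := by
  classical
  choose c hc using fun i => h i (e i)
  rw [Finset.prod_congr rfl fun i _ => hc i, Finset.prod_univ_sum]
  refine Submodule.sum_mem _ fun k _ => ?_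
  rw [Finset.prod_smul]
  exact Submodule.smul_mem _ _ (Submodule.subset_span ⟨k, rfl⟩)

/-- Let `S` be a commutative ring, `B` a commutative `S`-algebra, `N` a
positive integer, and `d 0, …, d (p-1) ∈ B` elements which generate `B` as an `S`-algebra.
Suppose for each `i` the element `T_N (d i)` (the `N`-th Chebyshev polynomial of the first
kind evaluated at `d i`) lies in the image of the structure map `S → B`.  Then `B` is
generated as an `S`-module by the `N ^ p` monomials `d 0 ^ k 0 * ⋯ * d (p-1) ^ k (p-1)`
with `0 ≤ k i ≤ N - 1` for all `i`. -/
theorem stmt_5 {S B : Type*} [CommRing S] [CommRing B] [Algebra S B]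
    (N : ℕ) (hN : 0 < N) {p : ℕ} (d : Fin p → B)
    (hgen : Algebra.adjoin S (Set.range d) = ⊤)
    (hT : ∀ i : Fin p, Polynomial.aeval (d i) (chebT N) ∈ (algebraMap S B).range) :
    Submodule.span S
      (Set.range fun k : Fin p → Fin N => ∏ i, d i ^ (k i : ℕ)) = ⊤ := by
  rw [eq_top_iff]
  intro b _
  have hb : b ∈ (MvPolynomial.aeval (R := S) d).range := by
    rw [← Algebra.adjoin_range_eq_range_aeval, hgen]
    exact Algebra.mem_top
  obtain ⟨P, rfl⟩ := hb
  change MvPolynomial.aeval d P ∈ _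
  rw [MvPolynomial.aeval_def, MvPolynomial.eval₂_eq']
  refine Submodule.sum_mem _ fun e _ => ?_
  rw [← Algebra.smul_def]
  exact Submodule.smul_mem _ _ <| prod_mem_span_range_prod_pow d (fun i =>
    exists_pow_eq_sum_of_aeval_mem_range (chebT_monic hN) (natDegree_chebT hN) hN (hT i)) e
end

section
/- Let N be a positive integer. Define φ : ℕ⁴ → Λ by: φ(k₁,k₂,k₃,k₄) = (0, 0, k₃+k₁, k₄+k₂) if k₁ = k₂; φ(k₁,k₂,k₃,k₄) = (k₁−k₂, 0, k₃+k₂, k₄+k₂) if k₁ > k₂; and φ(k₁,k₂,k₃,k₄) = (0, k₂−k₁, k₃+k₁, k₄+k₁) if k₁ < k₂. Let 𝒟 = {(0,k₂,k₃,k₄) ∈ Λ : 0 ≤ k₂,k₃,k₄ ≤ N−1}, and define ψ : Λ × 𝒟 → Λ by ψ(u,v) = φ(N·u + v), where N·u + v is computed componentwise. Then ψ is injective. -/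
/-- The map `φ : ℕ⁴ → Λ` of the paper:
`φ(k₁,k₂,k₃,k₄) = (0, 0, k₃+k₁, k₄+k₂)` if `k₁ = k₂`;
`φ(k₁,k₂,k₃,k₄) = (k₁−k₂, 0, k₃+k₂, k₄+k₂)` if `k₁ > k₂`;
`φ(k₁,k₂,k₃,k₄) = (0, k₂−k₁, k₃+k₁, k₄+k₁)` if `k₁ < k₂`. -/
def phi (k : ℕ × ℕ × ℕ × ℕ) : ℕ × ℕ × ℕ × ℕ :=
  if k.1 = k.2.1 then (0, 0, k.2.2.1 + k.1, k.2.2.2 + k.2.1)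
  else if k.2.1 < k.1 then (k.1 - k.2.1, 0, k.2.2.1 + k.2.1, k.2.2.2 + k.2.1)
  else (0, k.2.1 - k.1, k.2.2.1 + k.1, k.2.2.2 + k.1)

/-- The componentwise combination `N·u + v` of two quadruples of naturals. -/
def combine (N : ℕ) (u v : ℕ × ℕ × ℕ × ℕ) : ℕ × ℕ × ℕ × ℕ :=
  (N * u.1 + v.1, N * u.2.1 + v.2.1, N * u.2.2.1 + v.2.2.1, N * u.2.2.2 + v.2.2.2)

/-- Membership in `Λ`: quadruples `(k₁,k₂,k₃,k₄)` of naturals with `k₁k₂ = 0`. -/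
def inLambda (k : ℕ × ℕ × ℕ × ℕ) : Prop := k.1 * k.2.1 = 0

/-- Membership in `𝒟`: quadruples `(0,k₂,k₃,k₄) ∈ Λ` with `0 ≤ k₂,k₃,k₄ ≤ N−1`. -/
def inD (N : ℕ) (k : ℕ × ℕ × ℕ × ℕ) : Prop :=
  k.1 = 0 ∧ k.2.1 ≤ N - 1 ∧ k.2.2.1 ≤ N - 1 ∧ k.2.2.2 ≤ N - 1

/-- `k₁ - k₂`, `k₁ + k₃` and `k₁ + k₄` are invariants of `phi`. -/
theorem invariants_eq_of_phi_eq {k l : ℕ × ℕ × ℕ × ℕ} (h : phi k = phi l) :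
    k.1 + l.2.1 = l.1 + k.2.1 ∧ k.1 + k.2.2.1 = l.1 + l.2.2.1 ∧
      k.1 + k.2.2.2 = l.1 + l.2.2.2 := by
  unfold phi at h
  split_ifs at h <;> simp only [Prod.mk.injEq] at h <;> omega

/-- Uniqueness of quotient and remainder in Euclidean division by `N`. -/
theorem eq_and_eq_of_mul_add_eq {N a b r s : ℕ} (hr : r < N) (hs : s < N)
    (h : N * a + r = N * b + s) : a = b ∧ r = s := by
  have hrs : r = s := by
    simpa [Nat.mul_add_mod, Nat.mod_eq_of_lt hr, Nat.mod_eq_of_lt hs] using congrArg (· % N) h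
  subst hrs
  exact ⟨Nat.eq_of_mul_eq_mul_left (Nat.zero_lt_of_lt hr) (Nat.add_right_cancel h), rfl⟩

/-- Let `N` be a positive integer.  The map
`ψ : Λ × 𝒟 → Λ`, `ψ(u,v) = φ(N·u + v)`, is injective. -/
theorem stmt_9 (N : ℕ) (hN : 0 < N)
    (u u' v v' : ℕ × ℕ × ℕ × ℕ)
    (hu : inLambda u) (hu' : inLambda u') (hv : inD N v) (hv' : inD N v')
    (h : phi (combine N u v) = phi (combine N u' v')) :
    u = u' ∧ v = v' := by
  obtain ⟨h₂, h₃, h₄⟩ := invariants_eq_of_phi_eq h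
  obtain ⟨u₁, u₂, u₃, u₄⟩ := u
  obtain ⟨u₁', u₂', u₃', u₄'⟩ := u'
  obtain ⟨v₁, v₂, v₃, v₄⟩ := v
  obtain ⟨v₁', v₂', v₃', v₄'⟩ := v'
  simp only [inLambda, inD, combine, mul_eq_zero] at *
  obtain ⟨rfl, hv₂, hv₃, hv₄⟩ := hv
  obtain ⟨rfl, hv₂', hv₃', hv₄'⟩ := hv'
  obtain ⟨e₂, f₂⟩ := eq_and_eq_of_mul_add_eq (N := N) (a := u₁ + u₂') (b := u₁' + u₂)
    (r := v₂') (s := v₂) (by omega) (by omega) (by linarith)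
  obtain ⟨e₃, f₃⟩ := eq_and_eq_of_mul_add_eq (N := N) (a := u₁ + u₃) (b := u₁' + u₃')
    (r := v₃) (s := v₃') (by omega) (by omega) (by linarith)
  obtain ⟨e₄, f₄⟩ := eq_and_eq_of_mul_add_eq (N := N) (a := u₁ + u₄) (b := u₁' + u₄')
    (r := v₄) (s := v₄') (by omega) (by omega) (by linarith)
  simp only [Prod.mk.injEq, true_and]
  omega
end

section
/- Let R be an associative unital ℂ-algebra, q ∈ ℂ a nonzero complex number, and a, b, c, d ∈ R elements satisfying ca = q²ac, db = q²bd, ba = q²ab, dc = q²cd, bc = cb, ad − q⁻²bc = 1 and da − q²cb = 1. Then for every natural number t, d·E_t = E_t·d and a·E_t = E_t·a as subsets of R; that is, for every f ∈ E_t there exist g, h ∈ E_t with d·f = g·d and f·d = d·h, and likewise with d replaced by a. -/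
/-- The subsets `E t ⊆ R` of the paper: `E 0 = {1}` and, for `t ≥ 1`, `E t` is the set of
elements of the form `q^s·(bc)^t + k_{t−1}·(bc)^{t−1} + ⋯ + k₁·(bc) + 1` with `s ∈ ℤ` and
`k₁, …, k_{t−1} ∈ ℂ`. -/
def Eset {R : Type*} [Ring R] [Algebra ℂ R] (q : ℂ) (b c : R) : ℕ → Set R
  | 0 => {1}
  | (t + 1) => {x | ∃ (s : ℤ) (k : ℕ → ℂ),
      x = (q ^ s) • (b * c) ^ (t + 1) + (∑ j ∈ Finset.Icc 1 t, k j • (b * c) ^ j) + 1}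

/-- Elements of `Eset` pass through `y` whenever `y` twists `b * c` by an integer power of `q`:
`f` is a polynomial in `b * c`, and rescaling the variable by `q ^ n` preserves `Eset`. -/
theorem Eset_exists_rescale {R : Type*} [Ring R] [Algebra ℂ R] {q : ℂ} (hq : q ≠ 0) {b c : R}
    (n : ℤ) {t : ℕ} {f : R} (hf : f ∈ Eset q b c t) :
    ∃ g ∈ Eset q b c t,
      (∀ y, SemiconjBy y (b * c) (q ^ n • (b * c)) → SemiconjBy y f g) ∧
      (∀ y, SemiconjBy y (q ^ n • (b * c)) (b * c) → SemiconjBy y g f) := by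
  cases t with
  | zero =>
    obtain rfl : f = 1 := hf
    exact ⟨1, rfl, fun y _ => SemiconjBy.one_right y, fun y _ => SemiconjBy.one_right y⟩
  | succ t =>
    obtain ⟨s, k, rfl⟩ := hf
    have semiconj_poly : ∀ y u v : R, SemiconjBy y u v →
        SemiconjBy y (q ^ s • u ^ (t + 1) + (∑ j ∈ Finset.Icc 1 t, k j • u ^ j) + 1)
          (q ^ s • v ^ (t + 1) + (∑ j ∈ Finset.Icc 1 t, k j • v ^ j) + 1) := by
      intro y u v h
      have smul_pow_semiconj (r : ℂ) (j : ℕ) : y * (r • u ^ j) = r • v ^ j * y := by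
        rw [mul_smul_comm, smul_mul_assoc, (h.pow_right j).eq]
      refine SemiconjBy.add_right (SemiconjBy.add_right (smul_pow_semiconj _ _) ?_)
        (SemiconjBy.one_right y)
      simp only [SemiconjBy, Finset.mul_sum, Finset.sum_mul, smul_pow_semiconj]
    refine ⟨_, ⟨s + n * (t + 1 : ℕ), fun j => k j * (q ^ n) ^ j, rfl⟩, ?_⟩
    have rescale : q ^ s • (q ^ n • (b * c)) ^ (t + 1) +
        (∑ j ∈ Finset.Icc 1 t, k j • (q ^ n • (b * c)) ^ j) + 1 =
        q ^ (s + n * (t + 1 : ℕ)) • (b * c) ^ (t + 1) +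
        (∑ j ∈ Finset.Icc 1 t, (k j * (q ^ n) ^ j) • (b * c) ^ j) + 1 := by
      simp only [smul_pow, smul_smul, zpow_add₀ hq, zpow_mul, zpow_natCast]
    rw [← rescale]
    exact ⟨fun y => semiconj_poly y _ _, fun y => semiconj_poly y _ _⟩

/-- Let `R` be an associative unital `ℂ`-algebra, `q ∈ ℂ` nonzero, and
`a, b, c, d ∈ R` satisfying the `O_q(SL₂)` relations `ca = q²ac`, `db = q²bd`, `ba = q²ab`,
`dc = q²cd`, `bc = cb`, `ad − q⁻²bc = 1`, `da − q²cb = 1`.  Then for every natural number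
`t`, `d·E_t = E_t·d` and `a·E_t = E_t·a` as subsets of `R`: for every `f ∈ E_t` there exist
`g, h ∈ E_t` with `d·f = g·d` and `f·d = d·h`, and likewise with `d` replaced by `a`. -/
theorem stmt_11 {R : Type*} [Ring R] [Algebra ℂ R] (q : ℂ) (hq : q ≠ 0)
    (a b c d : R)
    (h1 : c * a = (q ^ 2) • (a * c)) (h2 : d * b = (q ^ 2) • (b * d))
    (h3 : b * a = (q ^ 2) • (a * b)) (h4 : d * c = (q ^ 2) • (c * d))
    (h5 : b * c = c * b)
    (h6 : a * d - (q ^ (-2 : ℤ)) • (b * c) = 1)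
    (h7 : d * a - (q ^ 2) • (c * b) = 1) :
    ∀ t : ℕ, ∀ f ∈ Eset q b c t,
      (∃ g ∈ Eset q b c t, d * f = g * d) ∧ (∃ h ∈ Eset q b c t, f * d = d * h) ∧
      (∃ g ∈ Eset q b c t, a * f = g * a) ∧ (∃ h ∈ Eset q b c t, f * a = a * h) := by
  have hd : d * (b * c) = q ^ (4 : ℤ) • (b * c) * d := by
    rw [← mul_assoc, h2, smul_mul_assoc, mul_assoc, h4, mul_smul_comm, smul_smul, smul_mul_assoc,
      mul_assoc]
    congr 1
    norm_cast
    ring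
  have ha : b * c * a = q ^ (4 : ℤ) • (a * (b * c)) := by
    rw [mul_assoc, h1, mul_smul_comm, ← mul_assoc, h3, smul_mul_assoc, smul_smul, mul_assoc]
    congr 1
    norm_cast
    ring
  have hd' : d * (q ^ (-4 : ℤ) • (b * c)) = b * c * d := by
    rw [mul_smul_comm, hd, smul_mul_assoc, smul_smul, ← zpow_add₀ hq]
    simp
  have ha' : a * (b * c) = q ^ (-4 : ℤ) • (b * c) * a := by
    rw [smul_mul_assoc, ha, smul_smul, ← zpow_add₀ hq]
    simp
  intro t f hf
  obtain ⟨g, hg, hfg, hgf⟩ := Eset_exists_rescale hq 4 hf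
  obtain ⟨h, hh, hfh, hhf⟩ := Eset_exists_rescale hq (-4) hf
  refine ⟨⟨g, hg, hfg d hd⟩, ⟨h, hh, (hhf d hd').eq.symm⟩, ⟨h, hh, hfh a ha'⟩,
    ⟨g, hg, (hgf a ?_).eq.symm⟩⟩
  rw [SemiconjBy, mul_smul_comm, ha]
end

section
/- Let R be an associative unital ℂ-algebra, q ∈ ℂ a nonzero complex number, and a, b, c, d ∈ R elements satisfying ca = q²ac, db = q²bd, ba = q²ab, dc = q²cd, bc = cb, ad − q⁻²bc = 1 and da − q²cb = 1. Then for every natural number t, the element aᵗdᵗ belongs to E_t; i.e. there exist s ∈ ℤ and k₁, …, k_{t−1} ∈ ℂ such that aᵗdᵗ = q^s·(bc)^t + k_{t−1}·(bc)^{t−1} + ⋯ + k₁·(bc) + 1. -/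
open Polynomial in
/-- Evaluating at `b * c` a polynomial of degree at most `t` with constant coefficient `1` and
`t`-th coefficient a power of `q` gives an element of `Eset q b c t`. -/
theorem aeval_mem_Eset {R : Type*} [Ring R] [Algebra ℂ R] {q : ℂ} {b c : R} {t : ℕ} {p : ℂ[X]}
    {s : ℤ} (hdeg : p.natDegree ≤ t) (h0 : p.coeff 0 = 1) (ht : p.coeff t = q ^ s) :
    aeval (b * c) p ∈ Eset q b c t := by
  rw [aeval_eq_sum_range' (Nat.lt_succ_of_le hdeg)]
  cases t with
  | zero => simp [Eset, h0]
  | succ t =>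
    refine ⟨s, p.coeff, ?_⟩
    rw [Finset.sum_range_succ, ht, Finset.sum_range_succ', h0, pow_zero, one_smul,
      Finset.range_eq_Ico, Finset.sum_Ico_add' (fun j => p.coeff j • (b * c) ^ j) 0 t 1,
      zero_add, Finset.Ico_add_one_right_eq_Icc]
    abel

/-- If `d * x = r • (x * d)`, then `d ^ t * x = r ^ t • (x * d ^ t)`. -/
theorem pow_mul_eq_pow_smul_mul_pow {K R : Type*} [CommSemiring K] [Semiring R] [Algebra K R]
    {r : K} {x d : R} (h : d * x = r • (x * d)) (t : ℕ) :
    d ^ t * x = r ^ t • (x * d ^ t) := by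
  induction t with
  | zero => simp
  | succ t ih =>
    rw [pow_succ, mul_assoc, h, mul_smul_comm, ← mul_assoc, ih, smul_mul_assoc, smul_smul,
      mul_assoc, pow_succ' r]

open Polynomial in
/-- If `d * x = q ^ 4 • (x * d)` and `a * d = 1 + q ^ (-2) • x`, then `a ^ t * d ^ t` is a
polynomial in `x` of degree at most `t`, with constant coefficient `1` and `t`-th coefficient a
power of `q`. -/
theorem exists_aeval_eq_pow_mul_pow {K R : Type*} [Field K] [Ring R] [Algebra K R] {q : K}
    (hq : q ≠ 0) {a d x : R} (hdx : d * x = q ^ 4 • (x * d))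
    (had : a * d = 1 + q ^ (-2 : ℤ) • x) (t : ℕ) :
    ∃ p : K[X], p.natDegree ≤ t ∧ p.coeff 0 = 1 ∧ (∃ s : ℤ, p.coeff t = q ^ s) ∧
      aeval x p = a ^ t * d ^ t := by
  induction t with
  | zero => exact ⟨1, by simp, by simp, ⟨0, by simp⟩, by simp⟩
  | succ t ih =>
    obtain ⟨p, hdeg, h0, ⟨s, hs⟩, hp⟩ := ih
    have hxd : x * d ^ t = q ^ (-4 * t : ℤ) • (d ^ t * x) := by
      rw [pow_mul_eq_pow_smul_mul_pow hdx, smul_smul, ← pow_mul, ← zpow_natCast, ← zpow_add₀ hq]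
      simp
    refine ⟨p + C (q ^ (-2 + -4 * t : ℤ)) * (p * X), ?_, ?_, ⟨-2 + -4 * t + s, ?_⟩, ?_⟩
    · refine natDegree_add_le_of_degree_le (by lia) ((natDegree_C_mul_le _ _).trans ?_)
      exact natDegree_mul_le.trans (add_le_add hdeg natDegree_X_le)
    · simp [h0]
    · rw [coeff_add, coeff_eq_zero_of_natDegree_lt (by lia), coeff_C_mul, coeff_mul_X, hs,
        zero_add, ← zpow_add₀ hq]
    · calc aeval x (p + C (q ^ (-2 + -4 * t : ℤ)) * (p * X))
          = a ^ t * d ^ t + q ^ (-2 + -4 * t : ℤ) • (a ^ t * d ^ t * x) := by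
            simp [hp, Algebra.smul_def]
        _ = a ^ t * (a * d) * d ^ t := by
            rw [had, mul_assoc (a ^ t) (1 + _), add_mul, smul_mul_assoc, hxd, smul_smul,
              ← zpow_add₀ hq]
            simp [mul_add, mul_assoc]
        _ = a ^ (t + 1) * d ^ (t + 1) := by
            rw [pow_succ, pow_succ' d]
            simp only [mul_assoc]


/-- Let `R` be an associative unital `ℂ`-algebra, `q ∈ ℂ` nonzero, and
`a, b, c, d ∈ R` satisfying the `O_q(SL₂)` relations `ca = q²ac`, `db = q²bd`, `ba = q²ab`,
`dc = q²cd`, `bc = cb`, `ad − q⁻²bc = 1`, `da − q²cb = 1`.  Then for every natural number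
`t`, the element `aᵗdᵗ` belongs to `E_t`. -/
theorem stmt_12 {R : Type*} [Ring R] [Algebra ℂ R] (q : ℂ) (hq : q ≠ 0)
    (a b c d : R)
    (h1 : c * a = (q ^ 2) • (a * c)) (h2 : d * b = (q ^ 2) • (b * d))
    (h3 : b * a = (q ^ 2) • (a * b)) (h4 : d * c = (q ^ 2) • (c * d))
    (h5 : b * c = c * b)
    (h6 : a * d - (q ^ (-2 : ℤ)) • (b * c) = 1)
    (h7 : d * a - (q ^ 2) • (c * b) = 1) :
    ∀ t : ℕ, a ^ t * d ^ t ∈ Eset q b c t := by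
  intro t
  have hdx : d * (b * c) = q ^ 4 • (b * c * d) := by
    rw [← mul_assoc, h2, smul_mul_assoc, mul_assoc, h4, mul_smul_comm, smul_smul, ← mul_assoc,
      ← pow_add]
  obtain ⟨p, hdeg, h0, ⟨s, hs⟩, hp⟩ :=
    exists_aeval_eq_pow_mul_pow hq hdx (sub_eq_iff_eq_add.mp h6) t
  exact hp ▸ aeval_mem_Eset hdeg h0 hs
end
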